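/- Sublevel counterexample in two dimensions: for the curve γ(t) = (t, t^k sin(1/t)) (t > 0, k ≥ 2 an integer), if the estimate ‖f * ν_γ‖_{L^q(ℝ²)} ≤ C‖f‖_{L^p(ℝ²)} holds with ν_γ the affine arclength measure, then testing on f = χ_{D_δ} with D_δ = {(x,y) : |x| ≤ δ, |y| ≤ δ^k} for all small δ > 0 forces 1/q ≥ 1/p − (k−1)/(3(k+1)). -/

import Mathlib

open MeasureTheory

/-- The second coordinate `t ↦ t^k sin(1/t)` of the curve. -/
noncomputable def oscCurve (k : ℕ) : ℝ → ℝ := fun t => t ^ k * Real.sin (1 / t)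

/-- `L_γ(t) = det(γ'(t), γ''(t))` for `γ(t) = (t, t^k sin(1/t))`. -/
noncomputable def oscL (k : ℕ) (t : ℝ) : ℝ :=
  deriv (fun x : ℝ => x) t * deriv (deriv (oscCurve k)) t -
    deriv (oscCurve k) t * deriv (deriv (fun x : ℝ => x)) t

/-- Convolution with the affine arclength measure of `γ(t) = (t, t^k sin(1/t))`, `t > 0`. -/
noncomputable def oscAvg (k : ℕ) (f : ℝ × ℝ → ℝ) : ℝ × ℝ → ℝ :=
  fun x => ∫ t in Set.Ioi (0 : ℝ),
    f (x - (t, oscCurve k t)) * |oscL k t| ^ ((1 : ℝ) / 3)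

/-- The bracket in `L = t^{k-4} g`. -/
noncomputable def oscG (k : ℕ) (t : ℝ) : ℝ :=
  ((k : ℝ) * (k - 1) * t ^ 2 - 1) * Real.sin (1 / t) - 2 * ((k : ℝ) - 1) * t * Real.cos (1 / t)

lemma hasDerivAt_sin_div (a t : ℝ) (ht : t ≠ 0) :
    HasDerivAt (fun x => Real.sin (a / x)) (-(a / t ^ 2) * Real.cos (a / t)) t := by
  have h := ((hasDerivAt_inv ht).const_mul a).sin
  refine (h.congr_deriv ?_)
  simp only [div_eq_mul_inv]; ring

lemma hasDerivAt_cos_div (a t : ℝ) (ht : t ≠ 0) :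
    HasDerivAt (fun x => Real.cos (a / x)) ((a / t ^ 2) * Real.sin (a / t)) t := by
  have h := ((hasDerivAt_inv ht).const_mul a).cos
  refine (h.congr_deriv ?_)
  simp only [div_eq_mul_inv]; ring

lemma nat_mul_pow_pred (m : ℕ) (t : ℝ) (ht : t ≠ 0) :
    (m : ℝ) * t ^ (m - 1) = m * (t ^ m / t) := by
  rcases m with _ | m
  · simp
  · simp [pow_succ, ht]

lemma osc_deriv1 (k : ℕ) (t : ℝ) (ht : t ≠ 0) :
    deriv (oscCurve k) t = k * (t ^ k / t) * Real.sin (1 / t) - t ^ k / t ^ 2 * Real.cos (1 / t) := by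
  have h : HasDerivAt (oscCurve k) _ t := (hasDerivAt_pow k t).mul (hasDerivAt_sin_div 1 t ht)
  rw [h.deriv, nat_mul_pow_pred k t ht]; ring

lemma osc_deriv2 (k : ℕ) (t : ℝ) (ht : t ≠ 0) :
    deriv (deriv (oscCurve k)) t = t ^ k / t ^ 4 * oscG k t := by
  have he : deriv (oscCurve k) =ᶠ[nhds t]
      fun t => k * (t ^ k / t) * Real.sin (1 / t) - t ^ k / t ^ 2 * Real.cos (1 / t) := by
    filter_upwards [isOpen_ne.mem_nhds ht] with x hx using osc_deriv1 k x hx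
  rw [he.deriv_eq]
  have h1 := ((((hasDerivAt_pow k t).div (hasDerivAt_id t) ht).const_mul (k : ℝ)).mul
    (hasDerivAt_sin_div 1 t ht)).sub
    (((hasDerivAt_pow k t).div (hasDerivAt_pow 2 t) (pow_ne_zero 2 ht)).mul
    (hasDerivAt_cos_div 1 t ht))
  refine Eq.trans h1.deriv ?_
  rw [nat_mul_pow_pred k t ht]
  simp only [oscG, id, Pi.div_apply]
  field_simp
  push_cast
  ring

lemma oscL_eq_deriv (k : ℕ) : oscL k = deriv (deriv (oscCurve k)) := by
  funext t; simp [oscL]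

lemma oscL_eq (k : ℕ) (t : ℝ) (ht : t ≠ 0) : oscL k t = t ^ k / t ^ 4 * oscG k t := by
  rw [oscL_eq_deriv, osc_deriv2 k t ht]

lemma measurable_oscW (k : ℕ) : Measurable (fun t => |oscL k t| ^ ((1 : ℝ) / 3)) := by
  have : Measurable (oscL k) := by rw [oscL_eq_deriv]; exact measurable_deriv _
  exact (measurable_norm.comp this).pow_const _

/-- the size constant -/
noncomputable def oscM (k : ℕ) : ℝ := (k : ℝ) * (k - 1) + 2 * ((k : ℝ) - 1) + 1

lemma oscG_diff (k : ℕ) (hk : 2 ≤ k) (t : ℝ) (ht : 0 < t) (ht1 : t ≤ 1) :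
    |oscG k t + Real.sin (1 / t)| ≤ oscM k * t := by
  have hkr : (2 : ℝ) ≤ k := by exact_mod_cast hk
  have e : oscG k t + Real.sin (1 / t) =
    (k : ℝ) * (k - 1) * t ^ 2 * Real.sin (1 / t) - 2 * ((k : ℝ) - 1) * t * Real.cos (1 / t) := by
    unfold oscG; ring
  rw [e]
  have hs := Real.abs_sin_le_one (1 / t)
  have hc := Real.abs_cos_le_one (1 / t)
  have a1 : 0 ≤ (k : ℝ) * (k - 1) * t ^ 2 := by
    have : (0:ℝ) ≤ k - 1 := by linarith
    positivity
  have a2 : 0 ≤ 2 * ((k : ℝ) - 1) * t := by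
    have : (0:ℝ) ≤ k - 1 := by linarith
    positivity
  have a3 : (k : ℝ) * (k - 1) * t ^ 2 ≤ (k : ℝ) * (k - 1) * t := by
    have : (0:ℝ) ≤ k - 1 := by linarith
    apply mul_le_mul_of_nonneg_left _ (by positivity)
    nlinarith
  refine (abs_sub _ _).trans ?_
  rw [abs_mul, abs_mul _ (Real.cos _), abs_of_nonneg a1, abs_of_nonneg a2]
  unfold oscM
  nlinarith [mul_le_mul_of_nonneg_left hs a1, mul_le_mul_of_nonneg_left hc a2]

lemma oscM_pos (k : ℕ) (hk : 2 ≤ k) : 1 ≤ oscM k := by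
  have hkr : (2 : ℝ) ≤ k := by exact_mod_cast hk
  unfold oscM; nlinarith

lemma oscG_le (k : ℕ) (hk : 2 ≤ k) (t : ℝ) (ht : 0 < t) (ht1 : t ≤ 1) :
    |oscG k t| ≤ 2 * oscM k := by
  have h := oscG_diff k hk t ht ht1
  have hs := abs_le.1 (Real.abs_sin_le_one (1 / t))
  have hM := oscM_pos k hk
  have h2 : oscM k * t ≤ oscM k := by nlinarith
  rw [abs_le] at *
  constructor <;> linarith

lemma oscW_eq (k : ℕ) (t : ℝ) (ht : 0 < t) :
    |oscL k t| ^ ((1 : ℝ) / 3) = t ^ (((k : ℝ) - 4) / 3) * |oscG k t| ^ ((1 : ℝ) / 3) := by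
  rw [oscL_eq k t ht.ne', abs_mul, Real.mul_rpow (abs_nonneg _) (abs_nonneg _)]
  congr 1
  rw [abs_of_pos (by positivity), ← Real.rpow_natCast, ← Real.rpow_natCast, ← Real.rpow_sub ht,
    ← Real.rpow_mul ht.le]
  congr 1; push_cast; ring

lemma oscW_int (k : ℕ) (hk : 2 ≤ k) :
    IntegrableOn (fun t => |oscL k t| ^ ((1 : ℝ) / 3)) (Set.Ioc 0 1) := by
  have hkr : (2 : ℝ) ≤ k := by exact_mod_cast hk
  have h1 : IntegrableOn (fun t : ℝ => t ^ (((k : ℝ) - 4) / 3)) (Set.Ioc 0 1) := by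
    rw [← intervalIntegrable_iff_integrableOn_Ioc_of_le zero_le_one]
    exact intervalIntegral.intervalIntegrable_rpow' (by linarith)
  refine Integrable.mono' (h1.mul_const ((2 * oscM k) ^ ((1 : ℝ) / 3)))
    (measurable_oscW k).aestronglyMeasurable ?_
  filter_upwards [ae_restrict_mem measurableSet_Ioc] with t ht
  rw [Real.norm_of_nonneg (by positivity), oscW_eq k t ht.1]
  have := oscG_le k hk t ht.1 ht.2
  have := Real.rpow_nonneg ht.1.le (((k : ℝ) - 4) / 3)
  gcongr

lemma oscG_root (k : ℕ) (hk : 2 ≤ k) (t : ℝ) (ht : 0 < t) (ht1 : t ≤ 1) :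
    oscG k t ^ 2 / (2 * oscM k) ^ 2 ≤ |oscG k t| ^ ((1 : ℝ) / 3) := by
  have h := oscG_le k hk t ht ht1
  have hM := oscM_pos k hk
  set x := |oscG k t| with hx
  have hx0 : 0 ≤ x := abs_nonneg _
  have hy : x / (2 * oscM k) ≤ 1 := by rw [div_le_one (by linarith)]; exact h
  have hy0 : 0 ≤ x / (2 * oscM k) := by positivity
  rw [← sq_abs, ← hx, ← div_pow]
  calc (x / (2 * oscM k)) ^ 2 = (x / (2 * oscM k)) ^ (2 : ℝ) := by norm_cast
    _ ≤ (x / (2 * oscM k)) ^ ((1 : ℝ) / 3) :=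
        Real.rpow_le_rpow_of_exponent_ge' hy0 hy (by norm_num) (by norm_num)
    _ ≤ x ^ ((1 : ℝ) / 3) := by
        apply Real.rpow_le_rpow hy0 _ (by norm_num)
        apply div_le_self hx0; linarith

/-- comparison function -/
noncomputable def oscH (K t : ℝ) : ℝ := t / 4 + t ^ 2 * Real.sin (2 / t) / 8 - K * t ^ 2

lemma oscH_deriv (K t : ℝ) (ht : t ≠ 0) : HasDerivAt (oscH K)
    (1 / 4 + t * Real.sin (2 / t) / 4 - Real.cos (2 / t) / 4 - 2 * K * t) t := by
  have h := (((hasDerivAt_id t).div_const 4).add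
    (((hasDerivAt_pow 2 t).mul (hasDerivAt_sin_div 2 t ht)).div_const 8)).sub
    ((hasDerivAt_pow 2 t).const_mul K)
  refine HasDerivAt.congr_deriv h ?_
  field_simp
  push_cast
  ring

lemma oscH_le (k : ℕ) (hk : 2 ≤ k) (t : ℝ) (ht : 0 < t) (ht1 : t ≤ 1) :
    1 / 4 + t * Real.sin (2 / t) / 4 - Real.cos (2 / t) / 4 - 2 * (1 + oscM k ^ 2) * t
      ≤ oscG k t ^ 2 := by
  have h := oscG_diff k hk t ht ht1
  have hM := oscM_pos k hk
  have hc : Real.cos (2 / t) = 1 - 2 * Real.sin (1 / t) ^ 2 := by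
    rw [show 2 / t = 2 * (1 / t) by ring, Real.cos_two_mul, Real.cos_sq']; ring
  have hs := Real.sin_le_one (2 / t)
  have h2 : (oscG k t + Real.sin (1 / t)) ^ 2 ≤ (oscM k * t) ^ 2 := by
    rw [← sq_abs]; gcongr
  have h3 : (oscM k * t) ^ 2 ≤ oscM k ^ 2 * t := by
    rw [mul_pow]; gcongr; nlinarith
  have h4 : t * Real.sin (2 / t) ≤ t := by nlinarith
  rw [hc]
  have : 0 ≤ oscM k ^ 2 * t := by positivity
  nlinarith [sq_nonneg (2 * oscG k t + Real.sin (1/t))]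

lemma oscH_diff (K r : ℝ) (hK : 0 ≤ K) (hr : 0 < r) (hr1 : r ≤ 1 / (16 * (K + 1))) :
    r / 16 ≤ oscH K r - oscH K (r / 2) := by
  unfold oscH
  have h1 := Real.neg_one_le_sin (2 / r)
  have h2 := Real.sin_le_one (2 / (r / 2))
  rw [le_div_iff₀ (by positivity)] at hr1
  have h3 : r ^ 2 * Real.sin (2 / r) ≥ - r ^ 2 := by nlinarith [sq_nonneg r]
  have h4 : (r / 2) ^ 2 * Real.sin (2 / (r / 2)) ≤ (r / 2) ^ 2 := by nlinarith [sq_nonneg r]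
  have h5 : r * (r * (16 * (K + 1))) ≤ r * 1 := by gcongr
  have : 0 ≤ K * r ^ 2 := by positivity
  nlinarith

lemma oscW_lower (k : ℕ) (hk : 2 ≤ k) : ∃ c : ℝ, 0 < c ∧ ∃ r₀ : ℝ, 0 < r₀ ∧ r₀ ≤ 1 ∧ ∀ r, 0 < r → r ≤ r₀ →
    c * r ^ (((k : ℝ) - 1) / 3) ≤ ∫ t in Set.Ioc 0 r, |oscL k t| ^ ((1 : ℝ) / 3) := by
  have hM := oscM_pos k hk
  set K := 1 + oscM k ^ 2 with hKdef
  have hK : 0 ≤ K := by positivity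
  refine ⟨(1 / 2 : ℝ) ^ ((k : ℝ) / 3) / (2 * oscM k) ^ 2 / 16, by positivity,
    1 / (16 * (K + 1)), by positivity, ?_, ?_⟩
  · rw [div_le_one (by positivity)]; linarith
  intro r hr hr1
  have hr2 : r ≤ 1 := hr1.trans (by rw [div_le_one (by positivity)]; linarith)
  have hint := oscW_int k hk
  set a : ℝ := (r / 2) ^ ((k : ℝ) / 3) / r ^ ((4 : ℝ) / 3) / (2 * oscM k) ^ 2 with ha
  have ha0 : 0 ≤ a := by positivity
  have key := intervalIntegral.sub_le_integral_of_hasDeriv_right_of_le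
    (g := fun t => a * oscH K t) (a := r / 2) (b := r)
    (g' := fun t => a * (1 / 4 + t * Real.sin (2 / t) / 4 - Real.cos (2 / t) / 4 - 2 * K * t))
    (φ := fun t => |oscL k t| ^ ((1 : ℝ) / 3)) (by linarith)
    (fun t ht => (((oscH_deriv K t (by linarith [ht.1])).const_mul a).continuousAt).continuousWithinAt)
    (fun t ht => ((oscH_deriv K t (by linarith [ht.1])).const_mul a).hasDerivWithinAt)
    (hint.mono_set fun t ht => ⟨by linarith [ht.1], by linarith [ht.2]⟩)
    (fun t ht => by
      have ht0 : 0 < t := by linarith [ht.1]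
      have ht1 : t ≤ 1 := by linarith [ht.2]
      rw [oscW_eq k t ht0]
      refine (mul_le_mul_of_nonneg_left (oscH_le k hk t ht0 ht1) ha0).trans ?_
      rw [ha, div_mul_eq_mul_div, mul_div_assoc]
      refine mul_le_mul ?_ (oscG_root k hk t ht0 ht1) (by positivity) (by positivity)
      rw [sub_div, Real.rpow_sub ht0]
      have := ht.1.le
      have := ht.2.le
      gcongr)
  calc _ = a * (r / 16) := by
        rw [ha, div_eq_mul_one_div r 2, mul_comm r, Real.mul_rpow (by norm_num) hr.le,
          show ((k : ℝ) - 1) / 3 = k / 3 - 4 / 3 + 1 by ring, Real.rpow_add hr, Real.rpow_sub hr,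
          Real.rpow_one]
        ring
    _ ≤ a * (oscH K r - oscH K (r / 2)) := by
        gcongr; exact oscH_diff K r hK hr hr1
    _ ≤ ∫ t in (r / 2)..r, |oscL k t| ^ ((1 : ℝ) / 3) := by
        rw [mul_sub]; exact key
    _ ≤ _ := by
        rw [intervalIntegral.integral_of_le (by linarith)]
        apply setIntegral_mono_set
        · exact hint.mono_set (Set.Ioc_subset_Ioc_right hr2)
        · exact Filter.Eventually.of_forall fun t => by positivity
        · exact (Set.Ioc_subset_Ioc_left (by linarith)).eventuallyLE

/-- The box `D_δ`. -/
def oscD (k : ℕ) (δ : ℝ) : Set (ℝ × ℝ) := Set.Icc (-δ) δ ×ˢ Set.Icc (-(δ ^ k)) (δ ^ k)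

lemma oscAvg_lower (k : ℕ) (hk : 2 ≤ k) (δ : ℝ) (hδ : 0 < δ) (hδ1 : δ ≤ 1 / 2) (x : ℝ × ℝ)
    (hx : x ∈ Set.Icc (-(δ / 2)) (δ / 2) ×ˢ Set.Icc (-(δ ^ k / 2)) (δ ^ k / 2)) :
    (∫ t in Set.Ioc 0 (δ / 2), |oscL k t| ^ ((1 : ℝ) / 3)) ≤
      oscAvg k ((oscD k δ).indicator fun _ => 1) x := by
  obtain ⟨⟨hx1, hx2⟩, hx3, hx4⟩ := hx
  have hDm : MeasurableSet (oscD k δ) := measurableSet_Icc.prod measurableSet_Icc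
  have hcm : Measurable (oscCurve k) := by unfold oscCurve; fun_prop
  set F : ℝ → ℝ := fun t => (oscD k δ).indicator (fun _ => (1 : ℝ)) (x - (t, oscCurve k t)) *
    |oscL k t| ^ ((1 : ℝ) / 3) with hF
  have hFm : Measurable F := by
    refine Measurable.mul ?_ (measurable_oscW k)
    exact (measurable_const.indicator hDm).comp (by fun_prop)
  have hF0 : ∀ t, 0 ≤ F t := fun t =>
    mul_nonneg (Set.indicator_nonneg (fun _ _ => zero_le_one) _) (by positivity)
  have hw := oscW_int k hk
  have hFi1 : IntegrableOn F (Set.Ioc 0 1) := by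
    refine Integrable.mono' hw hFm.aestronglyMeasurable (Filter.Eventually.of_forall fun t => ?_)
    rw [Real.norm_of_nonneg (hF0 t)]
    refine mul_le_of_le_one_left (by positivity) ?_
    exact Set.indicator_le_self' (fun _ _ => zero_le_one) _
  have hFi : IntegrableOn F (Set.Ioi 0) := by
    rw [← Set.Ioc_union_Ioi_eq_Ioi zero_le_one]
    refine hFi1.union ?_
    refine integrableOn_zero.congr_fun (fun t ht => ?_) measurableSet_Ioi
    have htt : 1 < t := ht
    have : x - (t, oscCurve k t) ∉ oscD k δ := by
      rintro ⟨⟨h, _⟩, _⟩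
      simp at h hx2
      linarith
    simp [hF, this]
  calc _ = ∫ t in Set.Ioc 0 (δ / 2), F t := by
        refine setIntegral_congr_fun measurableSet_Ioc fun t ht => ?_
        have : x - (t, oscCurve k t) ∈ oscD k δ := by
          have hc : |oscCurve k t| ≤ δ ^ k / 2 := by
            unfold oscCurve
            rw [abs_mul, abs_of_nonneg (pow_nonneg ht.1.le k)]
            calc t ^ k * |Real.sin (1 / t)| ≤ (δ / 2) ^ k * 1 := by
                  have := ht.1.le
                  have := ht.2
                  gcongr
                  exact Real.abs_sin_le_one _
              _ ≤ δ ^ k / 2 := by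
                  rw [mul_one, div_pow]
                  gcongr
                  exact le_self_pow₀ (by norm_num) (by omega)
          rw [abs_le] at hc
          have := ht.1
          have := ht.2
          refine ⟨⟨?_, ?_⟩, ?_, ?_⟩ <;> simp only [Prod.fst_sub, Prod.snd_sub] <;> linarith
        simp [hF, this]
    _ ≤ ∫ t in Set.Ioi 0, F t := by
        apply setIntegral_mono_set hFi
        · exact Filter.Eventually.of_forall hF0
        · exact (Set.Ioc_subset_Ioi_self).eventuallyLE

lemma exponent_compare (a B A E δ₀ : ℝ) (ha : 0 < a) (hδ₀ : 0 < δ₀)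
    (h : ∀ δ, 0 < δ → δ ≤ δ₀ → a * δ ^ A ≤ B * δ ^ E) : E ≤ A := by
  by_contra hlt
  push Not at hlt
  have ht : Filter.Tendsto (fun δ : ℝ => B * δ ^ (E - A)) (nhdsWithin 0 (Set.Ioi 0)) (nhds (B * 0)) := by
    refine Filter.Tendsto.const_mul B ?_
    have := (Real.continuousAt_rpow_const 0 (E - A) (Or.inr (by linarith))).tendsto
    rw [Real.zero_rpow (by linarith)] at this
    exact this.mono_left nhdsWithin_le_nhds
  have := ge_of_tendsto (b := a) ht (by
    filter_upwards [Ioc_mem_nhdsGT hδ₀] with δ hδ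
    rw [Real.rpow_sub hδ.1, ← mul_div_assoc, le_div_iff₀ (Real.rpow_pos_of_pos hδ.1 _)]
    exact h δ hδ.1 hδ.2)
  linarith

lemma box_norm (u v c p : ℝ) (hu : 0 ≤ u) (hv : 0 ≤ v) (hc : 0 ≤ c) (hp : 1 ≤ p) :
    eLpNorm ((Set.Icc (-u) u ×ˢ Set.Icc (-v) v).indicator fun _ : ℝ × ℝ => c)
      (ENNReal.ofReal p) volume = ENNReal.ofReal (c * (4 * (u * v)) ^ (1 / p)) := by
  rw [eLpNorm_indicator_const (measurableSet_Icc.prod measurableSet_Icc)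
    (by simp; linarith) (by simp), Measure.volume_eq_prod, Measure.prod_prod, Real.volume_Icc,
    Real.volume_Icc, ← ENNReal.ofReal_mul (by linarith), ENNReal.toReal_ofReal (by linarith),
    ENNReal.ofReal_rpow_of_nonneg, Real.enorm_of_nonneg hc, ← ENNReal.ofReal_mul hc]
  · ring_nf
  · have : 0 ≤ u - -u := by linarith
    have : 0 ≤ v - -v := by linarith
    positivity
  · positivity

/-- Sublevel counterexample: if convolution with the affine arclength measure of
`γ(t) = (t, t^k sin(1/t))` maps `L^p(ℝ²)` to `L^q(ℝ²)`, then
`1/q ≥ 1/p − (k−1)/(3(k+1))`. -/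
theorem stmt_15 (k : ℕ) (hk : 2 ≤ k) (p q : ℝ) (hp : 1 ≤ p) (hq : 1 ≤ q)
    (C : ℝ) (hC : 0 < C)
    (hbound : ∀ f : ℝ × ℝ → ℝ, Measurable f →
      eLpNorm (oscAvg k f) (ENNReal.ofReal q) volume ≤
        ENNReal.ofReal C * eLpNorm f (ENNReal.ofReal p) volume) :
    1 / p - ((k : ℝ) - 1) / (3 * ((k : ℝ) + 1)) ≤ 1 / q := by
  obtain ⟨c, hc, r₀, hr₀, hr₁, hlow⟩ := oscW_lower k hk
  have hkr : (2 : ℝ) ≤ k := by exact_mod_cast hk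
  have key := exponent_compare (c * (1 / 2) ^ (((k : ℝ) - 1) / 3)) (C * 4 ^ (1 / p))
    (((k : ℝ) - 1) / 3 + (k + 1) / q) ((k + 1) / p) (r₀ / 2) (by positivity) (by positivity) (by
    intro δ hδ hδ1
    have hb := hbound ((oscD k δ).indicator fun _ => 1)
      (measurable_const.indicator (measurableSet_Icc.prod measurableSet_Icc))
    set cc := c * (δ / 2) ^ (((k : ℝ) - 1) / 3) with hcc
    have hccn : 0 ≤ cc := by positivity
    have hm : eLpNorm ((Set.Icc (-(δ / 2)) (δ / 2) ×ˢ Set.Icc (-(δ ^ k / 2)) (δ ^ k / 2)).indicator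
        fun _ : ℝ × ℝ => cc) (ENNReal.ofReal q) volume ≤
        eLpNorm (oscAvg k ((oscD k δ).indicator fun _ => 1)) (ENNReal.ofReal q) volume := by
      refine eLpNorm_mono fun x => ?_
      by_cases hx : x ∈ Set.Icc (-(δ / 2)) (δ / 2) ×ˢ Set.Icc (-(δ ^ k / 2)) (δ ^ k / 2)
      · rw [Set.indicator_of_mem hx, Real.norm_of_nonneg hccn]
        exact (hlow (δ / 2) (by positivity) (by linarith)).trans
          ((oscAvg_lower k hk δ hδ (by linarith) x hx).trans (le_abs_self _))
      · rw [Set.indicator_of_notMem hx, norm_zero]; exact norm_nonneg _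
    have hfin := hm.trans hb
    have hpow : δ * δ ^ k = δ ^ ((k : ℝ) + 1) := by
      rw [Real.rpow_add hδ, Real.rpow_one, Real.rpow_natCast, mul_comm]
    rw [oscD, box_norm _ _ _ _ (by positivity) (by positivity) hccn hq,
      box_norm _ _ _ _ hδ.le (by positivity) zero_le_one hp, ← ENNReal.ofReal_mul hC.le,
      ENNReal.ofReal_le_ofReal_iff (by positivity),
      show 4 * (δ / 2 * (δ ^ k / 2)) = δ * δ ^ k by ring, hpow, ← Real.rpow_mul hδ.le,
      Real.mul_rpow (by norm_num) (by positivity), ← Real.rpow_mul hδ.le, hcc,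
      div_eq_mul_one_div δ 2, mul_comm δ, Real.mul_rpow (by norm_num) hδ.le] at hfin
    rw [Real.rpow_add hδ, div_eq_mul_one_div _ q, div_eq_mul_one_div ((k : ℝ) + 1) p]
    linarith)
  have h3 : ((k : ℝ) + 1) * (1 / p - ((k : ℝ) - 1) / (3 * ((k : ℝ) + 1))) ≤ ((k : ℝ) + 1) * (1 / q) := by
    have : ((k : ℝ) + 1) * (1 / p - ((k : ℝ) - 1) / (3 * ((k : ℝ) + 1))) =
        (k + 1) / p - ((k : ℝ) - 1) / 3 := by field_simp
    rw [this, mul_one_div]; linarith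
  exact le_of_mul_le_mul_left h3 (by positivity)
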